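/- arXiv:1103.1624 — 2 statements merged into one kernel-verified Lean document; each statement's English description precedes it below -/
import Mathlib

section
/- Let n ≥ 1, let K be a field with char K ≠ 2, and let W = (Fin n → ZMod 2) ⋊ Equiv.Perm (Fin n) be the hyperoctahedral group (the symmetric group acting by permuting coordinates); this group is isomorphic to the subgroup W_n ≤ Out(F_n) generated by ε_1 and the σ_{ij}. Let V be a finite-dimensional K-linear representation of W. For j ∈ Fin n let e_j ∈ W be the element whose vector part has j-th coordinate 1 and all other coordinates 0 and whose permutation part is the identity. For I ⊆ Fin n set E_I = {v ∈ V : e_j · v = (−1)^{χ_I(j)} v for all j ∈ Fin n}, where χ_I is the characteristic function of I, and for 0 ≤ i ≤ n set V_i = Σ_{|I| = i} E_I (the subspaces E_I are linearly independent, so this is an internal direct sum). Then the binomial coefficient C(n, i) divides dim_K V_i for every 0 ≤ i ≤ n. -/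
noncomputable section

/-- Coordinate permutation, as an additive automorphism of `(Fin n → ZMod 2)`. -/
def permAddAut (n : ℕ) (σ : Equiv.Perm (Fin n)) :
    (Fin n → ZMod 2) ≃+ (Fin n → ZMod 2) where
  toFun v := v ∘ σ.symm
  invFun v := v ∘ σ
  left_inv v := by funext i; simp
  right_inv v := by funext i; simp
  map_add' u v := rfl

/-- The action of `S_n` on `(ℤ/2)^n` by permuting coordinates. -/
def permActHom (n : ℕ) :
    Equiv.Perm (Fin n) →* MulAut (Multiplicative (Fin n → ZMod 2)) where
  toFun σ := AddEquiv.toMultiplicative (permAddAut n σ)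
  map_one' := by ext v; rfl
  map_mul' σ τ := by ext v; rfl

/-- The hyperoctahedral group `(ℤ/2)^n ⋊ S_n`. -/
abbrev Hyp (n : ℕ) : Type :=
  SemidirectProduct (Multiplicative (Fin n → ZMod 2)) (Equiv.Perm (Fin n)) (permActHom n)

/-- The element `e_j ∈ (ℤ/2)^n ⋊ S_n` whose vector part is the `j`-th standard basis
vector and whose permutation part is trivial. -/
def eHyp (n : ℕ) (j : Fin n) : Hyp n :=
  SemidirectProduct.inl (Multiplicative.ofAdd (Pi.single j 1))

/-- The simultaneous eigenspace `E_I ≤ V` on which `φ(e_j)` acts by `-1` for `j ∈ I` and by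
`1` for `j ∉ I`. -/
def EHyp (n : ℕ) {K V : Type} [Field K] [AddCommGroup V] [Module K V]
    (φ : Hyp n →* (Module.End K V)ˣ) (I : Finset (Fin n)) : Submodule K V where
  carrier :=
    {v | ∀ j : Fin n,
      (φ (eHyp n j) : Module.End K V) v = (if j ∈ I then (-1 : K) else 1) • v}
  add_mem' := by
    intro a b ha hb j
    rw [map_add, ha j, hb j, smul_add]
  zero_mem' := by
    intro j
    rw [map_zero, smul_zero]
  smul_mem' := by
    intro c v hv j
    rw [LinearMap.map_smul, hv j, smul_comm]

/-- The subspace `V_i = Σ_{|I| = i} E_I`. -/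
def VHyp (n : ℕ) {K V : Type} [Field K] [AddCommGroup V] [Module K V]
    (φ : Hyp n →* (Module.End K V)ˣ) (i : ℕ) : Submodule K V :=
  ⨆ (I : Finset (Fin n)) (_ : I.card = i), EHyp n φ I

/-- The dimension of the span of finitely many independent subspaces is the sum of their
dimensions. -/
theorem iSupIndep.finrank_iSup {ι K V : Type} [Fintype ι] [Field K] [AddCommGroup V] [Module K V]
    [FiniteDimensional K V] {p : ι → Submodule K V} (hp : iSupIndep p) :
    Module.finrank K (⨆ k, p k : Submodule K V) = ∑ k, Module.finrank K (p k) := by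
  classical
  rw [Submodule.iSup_eq_range_dfinsupp_lsum,
    LinearMap.finrank_range_of_inj hp.dfinsupp_lsum_injective]
  exact Module.finrank_directSum K fun k => p k

/-- Two finsets of the same size differ by a permutation of the ambient type. -/
theorem Finset.exists_perm_mem_iff_of_card_eq {α : Type*} [Fintype α] [DecidableEq α]
    {I J : Finset α} (h : I.card = J.card) : ∃ σ : Equiv.Perm α, ∀ x, σ x ∈ J ↔ x ∈ I := by
  let e : {x // x ∈ I} ≃ {x // x ∈ J} := Finset.equivOfCardEq h
  exact ⟨e.extendSubtype, fun x =>
    ⟨fun hx => by_contra fun hI => e.extendSubtype_not_mem x hI hx, e.extendSubtype_mem x⟩⟩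

theorem eHyp_commute (n : ℕ) (j k : Fin n) : Commute (eHyp n j) (eHyp n k) :=
  (Commute.all _ _).map SemidirectProduct.inl

theorem inr_mul_eHyp (n : ℕ) (σ : Equiv.Perm (Fin n)) (j : Fin n) :
    (SemidirectProduct.inr σ : Hyp n) * eHyp n j = eHyp n (σ j) * SemidirectProduct.inr σ := by
  have h : permActHom n σ (Multiplicative.ofAdd (Pi.single j 1)) =
      Multiplicative.ofAdd (Pi.single (σ j) 1) := by
    apply Multiplicative.toAdd.injective
    funext k
    change (Pi.single j 1 : Fin n → ZMod 2) (σ.symm k) = (Pi.single (σ j) 1 : Fin n → ZMod 2) k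
    simp [Pi.single_apply, Equiv.symm_apply_eq]
  rw [eHyp, eHyp, ← h, SemidirectProduct.inl_aut, map_inv, inv_mul_cancel_right]

section Eigenspaces

variable {n : ℕ} {K V : Type} [Field K] [AddCommGroup V] [Module K V]
  (φ : Hyp n →* (Module.End K V)ˣ)

/-- The subspaces `E_I` are linearly independent. -/
theorem iSupIndep_EHyp (hK : ringChar K ≠ 2) : iSupIndep (EHyp n φ) := by
  have hneg : (-1 : K) ≠ 1 := Ring.neg_one_ne_one_of_char_ne_two hK
  have hind := Module.End.independent_iInf_maxGenEigenspace_of_forall_mapsTo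
    (fun j => (φ (eHyp n j) : Module.End K V)) fun j k μ =>
      Module.End.mapsTo_maxGenEigenspace_of_comm
        (((eHyp_commute n k j).map φ).map (Units.coeHom (Module.End K V))) μ
  have hinj : Function.Injective
      fun (I : Finset (Fin n)) (j : Fin n) => if j ∈ I then (-1 : K) else 1 := by
    intro I J h
    ext j
    have hj := congrFun h j
    by_cases hI : j ∈ I <;> by_cases hJ : j ∈ J <;> simp_all [hneg.symm]
  refine (hind.comp hinj).mono fun I v hv => ?_
  simp only [Function.comp_apply, Submodule.mem_iInf]
  exact fun j => Module.End.eigenspace_le_maxGenEigenspace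
    (Module.End.mem_eigenspace_iff.mpr (hv j))

theorem map_inr_mem_EHyp {I J : Finset (Fin n)} {σ : Equiv.Perm (Fin n)}
    (hσ : ∀ x, σ x ∈ J ↔ x ∈ I) {v : V} (hv : v ∈ EHyp n φ I) :
    (φ (SemidirectProduct.inr σ) : Module.End K V) v ∈ EHyp n φ J := by
  intro j
  obtain ⟨j, rfl⟩ := σ.surjective j
  have h := congrArg (fun g => (φ g : Module.End K V) v) (inr_mul_eHyp n σ j)
  simp only [map_mul, Units.val_mul, Module.End.mul_apply] at h
  rw [← h, hv j, map_smul]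
  simp only [hσ]

theorem finrank_EHyp_le_of_card_eq [FiniteDimensional K V] {I J : Finset (Fin n)}
    (h : I.card = J.card) :
    Module.finrank K (EHyp n φ I) ≤ Module.finrank K (EHyp n φ J) := by
  obtain ⟨σ, hσ⟩ := Finset.exists_perm_mem_iff_of_card_eq h
  refine LinearMap.finrank_le_finrank_of_injective
    (f := (φ (SemidirectProduct.inr σ) : Module.End K V).restrict
      fun v hv => map_inr_mem_EHyp φ hσ hv) fun v w hvw => Subtype.ext ?_
  exact ((Module.End.isUnit_iff _).mp (φ (SemidirectProduct.inr σ)).isUnit).injective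
    (congrArg Subtype.val hvw)

end Eigenspaces

/-- For a finite-dimensional representation `V` of the hyperoctahedral
group `(ℤ/2)^n ⋊ S_n` over a field of characteristic `≠ 2`, the binomial coefficient
`C(n, i)` divides `dim V_i` for every `0 ≤ i ≤ n`. -/
theorem choose_dvd_finrank_VHyp (n : ℕ) (hn : 1 ≤ n) (K V : Type) [Field K]
    [AddCommGroup V] [Module K V] [FiniteDimensional K V] (hK : ringChar K ≠ 2)
    (φ : Hyp n →* (Module.End K V)ˣ) (i : ℕ) (hi : i ≤ n) :
    n.choose i ∣ Module.finrank K (VHyp n φ i) := by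
  obtain ⟨I₀, -, hI₀⟩ := Finset.exists_subset_card_eq
    (s := (Finset.univ : Finset (Fin n))) (n := i) (by simpa using hi)
  have hind : iSupIndep fun I : {I : Finset (Fin n) // I.card = i} => EHyp n φ I :=
    (iSupIndep_EHyp φ hK).comp Subtype.val_injective
  have hdim (I : {I : Finset (Fin n) // I.card = i}) :
      Module.finrank K (EHyp n φ I) = Module.finrank K (EHyp n φ I₀) :=
    (finrank_EHyp_le_of_card_eq φ (I.2.trans hI₀.symm)).antisymm
      (finrank_EHyp_le_of_card_eq φ (hI₀.trans I.2.symm))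
  rw [VHyp, iSup_subtype', hind.finrank_iSup, Finset.sum_congr rfl fun I _ => hdim I]
  simp
end
end

section
/- Let n ≥ 4 and let E be a finite set with at least two elements on which the alternating group A_{n+1} = alternatingGroup (Fin (n+1)) acts transitively. Consider the A_{n+1}-submodule W = {f : E → ℂ | Σ_{e ∈ E} f(e) = 0} of the permutation module ℂ^E, and let St = {x : Fin (n+1) → ℂ | Σ_i x_i = 0} be the standard representation of A_{n+1} (with the coordinate-permuting action). If W is isomorphic, as a module over A_{n+1}, to a direct sum of copies of St, then E has exactly n+1 elements. -/
noncomputable section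

/-- The sum-zero submodule of `ℂ^E` (the reduced permutation module). -/
def sumZero (E : Type) [Fintype E] : Submodule ℂ (E → ℂ) where
  carrier := {f | ∑ e, f e = 0}
  add_mem' := by
    intro a b ha hb
    simp only [Set.mem_setOf_eq, Pi.add_apply, Finset.sum_add_distrib] at *
    rw [ha, hb, add_zero]
  zero_mem' := by simp
  smul_mem' := by
    intro c f hf
    simp only [Set.mem_setOf_eq, Pi.smul_apply, smul_eq_mul, ← Finset.mul_sum] at *
    rw [hf, mul_zero]

lemma sumZero_perm_mem {E : Type} [Fintype E] (σ : Equiv.Perm E) {f : E → ℂ}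
    (hf : f ∈ sumZero E) : (fun x => f (σ x)) ∈ sumZero E := by
  have h : ∑ x, f (σ x) = ∑ x, f x := Equiv.sum_comp σ f
  show ∑ x, f (σ x) = 0
  rw [h]; exact hf

lemma sumZero_smul_mem {A E : Type} [Group A] [Fintype E] [MulAction A E] (g : A)
    {f : E → ℂ} (hf : f ∈ sumZero E) : (fun x => f (g⁻¹ • x)) ∈ sumZero E :=
  sumZero_perm_mem (MulAction.toPerm g⁻¹) hf

/-- The action of a permutation on the sum-zero submodule by precomposition. -/
def sumZeroPerm {E : Type} [Fintype E] (σ : Equiv.Perm E) : sumZero E →ₗ[ℂ] sumZero E :=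
  ((LinearMap.funLeft ℂ ℂ σ).comp (sumZero E).subtype).codRestrict (sumZero E)
    fun f => sumZero_perm_mem σ f.2

/-- The projection of `ℂ^E` onto the sum-zero submodule that subtracts the mean. -/
def sumZeroProj (E : Type) [Fintype E] [Nonempty E] : (E → ℂ) →ₗ[ℂ] sumZero E where
  toFun f := ⟨fun x => f x - (∑ y, f y) / Fintype.card E, by
    have h : (Fintype.card E : ℂ) ≠ 0 := by simp
    change ∑ x, (f x - (∑ y, f y) / Fintype.card E) = 0
    rw [Finset.sum_sub_distrib, Finset.sum_const, Finset.card_univ, nsmul_eq_mul,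
      mul_div_cancel₀ _ h, sub_self]⟩
  map_add' f g := by
    ext x
    simp only [Pi.add_apply, Finset.sum_add_distrib, Submodule.coe_add]
    ring
  map_smul' c f := by
    ext x
    simp only [Pi.smul_apply, smul_eq_mul, ← Finset.mul_sum, RingHom.id_apply,
      Submodule.coe_smul]
    ring

/-- The trace of an endomorphism of `ℂ^E` is the sum of its diagonal entries. -/
lemma trace_pi_eq_sum {E : Type} [Fintype E] [DecidableEq E] (T : (E → ℂ) →ₗ[ℂ] (E → ℂ)) :
    LinearMap.trace ℂ _ T = ∑ x, T (Pi.single x 1) x := by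
  rw [LinearMap.trace_eq_matrix_trace ℂ (Pi.basisFun ℂ E), Matrix.trace]
  simp

lemma trace_sumZeroPerm {E : Type} [Fintype E] [DecidableEq E] [Nonempty E]
    (σ : Equiv.Perm E) :
    LinearMap.trace ℂ _ (sumZeroPerm σ) =
      ((Finset.univ.filter fun x => σ x = x).card : ℂ) - 1 := by
  have hcard : (Fintype.card E : ℂ) ≠ 0 := by simp
  have hfac : sumZeroPerm σ =
      sumZeroProj E ∘ₗ ((sumZero E).subtype ∘ₗ sumZeroPerm σ) := by
    ext f x
    have h : ∑ y, (sumZeroPerm σ f : E → ℂ) y = 0 := (sumZeroPerm σ f).2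
    simp [sumZeroProj, h]
  rw [hfac, LinearMap.trace_comp_comm', LinearMap.comp_assoc, trace_pi_eq_sum]
  have hdiag (x : E) : ((sumZero E).subtype ∘ₗ sumZeroPerm σ ∘ₗ sumZeroProj E)
      (Pi.single x 1) x = (if σ x = x then 1 else 0) - 1 / (Fintype.card E : ℂ) := by
    simp [sumZeroPerm, sumZeroProj, LinearMap.funLeft, Pi.single_apply]
  simp [hdiag, hcard]

/-- The trace of the diagonal action on a finite power of a module. -/
lemma trace_pi_diagonal {V : Type*} [AddCommGroup V] [Module ℂ V] [FiniteDimensional ℂ V]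
    (k : ℕ) (S : V →ₗ[ℂ] V) :
    LinearMap.trace ℂ (Fin k → V) (LinearMap.pi fun t => S ∘ₗ LinearMap.proj t) =
      k * LinearMap.trace ℂ V S := by
  have hsum : (LinearMap.pi fun t => S ∘ₗ LinearMap.proj t : (Fin k → V) →ₗ[ℂ] (Fin k → V)) =
      ∑ t, LinearMap.single ℂ (fun _ => V) t ∘ₗ (S ∘ₗ LinearMap.proj t) := by
    refine LinearMap.ext fun v => funext fun s => ?_
    simp [LinearMap.sum_apply, Finset.sum_apply, Pi.single_apply]
  have hterm (t : Fin k) : LinearMap.trace ℂ (Fin k → V)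
      (LinearMap.single ℂ (fun _ => V) t ∘ₗ (S ∘ₗ LinearMap.proj t)) =
        LinearMap.trace ℂ V S := by
    rw [LinearMap.trace_comp_comm', LinearMap.comp_assoc, LinearMap.proj_comp_single_same,
      LinearMap.comp_id]
  rw [hsum, map_sum, Finset.sum_congr rfl fun t _ => hterm t]
  simp

/-- For `n ≥ 2` some even permutation of `Fin (n + 1)` has a fixed-point-free inverse. -/
lemma exists_alternatingGroup_inv_ne (n : ℕ) (hn : 2 ≤ n) :
    ∃ g : alternatingGroup (Fin (n + 1)),
      ∀ i, (g : Equiv.Perm (Fin (n + 1)))⁻¹ i ≠ i := by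
  refine ⟨⟨finRotate (n + 1) * finRotate (n + 1), ?_⟩, fun i hi => ?_⟩
  · rw [Equiv.Perm.mem_alternatingGroup, map_mul, Int.units_mul_self]
  · have h := Equiv.Perm.inv_eq_iff_eq.mp hi
    simp only [Equiv.Perm.mul_apply, finRotate_apply, add_assoc] at h
    have h2 : (1 + 1 : Fin (n + 1)) = 0 := by simpa using h.symm
    have h3 := congrArg Fin.val h2
    rw [Fin.val_add, Fin.val_one', Fin.val_zero, Nat.mod_eq_of_lt (by omega : 1 < n + 1),
      Nat.mod_eq_of_lt (by omega)] at h3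
    omega

/-- the Cage Lemma. Let `n ≥ 4` and let `E` be a finite set with at
least two elements on which `A_{n+1}` acts transitively.  If the sum-zero submodule `W`
of `ℂ^E` is isomorphic, as an `A_{n+1}`-module, to a direct sum of copies of the standard
representation (the sum-zero submodule of `ℂ^{n+1}`), then `E` has exactly `n+1`
elements. -/
theorem cage_lemma (n : ℕ) (hn : 4 ≤ n) (E : Type) [Fintype E]
    [MulAction (alternatingGroup (Fin (n + 1))) E]
    (hcard : 2 ≤ Fintype.card E)
    (htrans : MulAction.IsPretransitive (alternatingGroup (Fin (n + 1))) E)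
    (hiso : ∃ (k : ℕ) (e : sumZero E ≃ₗ[ℂ] (Fin k → sumZero (Fin (n + 1)))),
      ∀ (g : alternatingGroup (Fin (n + 1))) (f : E → ℂ) (hf : f ∈ sumZero E),
        e ⟨fun x => f (g⁻¹ • x), sumZero_smul_mem g hf⟩ =
          fun t => ⟨fun i => (e ⟨f, hf⟩ t : Fin (n + 1) → ℂ)
              ((g : Equiv.Perm (Fin (n + 1)))⁻¹ i),
            sumZero_perm_mem ((g : Equiv.Perm (Fin (n + 1))))⁻¹ (e ⟨f, hf⟩ t).2⟩) :
    Fintype.card E = n + 1 := by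
  classical
  obtain ⟨k, e, he⟩ := hiso
  have : Nonempty E := Fintype.card_pos_iff.mp (by omega)
  have htrace (g : alternatingGroup (Fin (n + 1))) :
      ((Finset.univ.filter fun x : E => g⁻¹ • x = x).card : ℂ) - 1 =
        k * (((Finset.univ.filter fun i => (g : Equiv.Perm (Fin (n + 1)))⁻¹ i = i).card : ℂ)
          - 1) := by
    have hconj : e.conj (sumZeroPerm (MulAction.toPerm g⁻¹)) =
        LinearMap.pi fun t => sumZeroPerm (g : Equiv.Perm (Fin (n + 1)))⁻¹ ∘ₗ
          LinearMap.proj t := by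
      refine LinearMap.ext fun v => ?_
      obtain ⟨f, rfl⟩ := e.surjective v
      rw [LinearEquiv.conj_apply_apply, e.symm_apply_apply]
      exact he g f.1 f.2
    have h := LinearMap.trace_conj' (sumZeroPerm (MulAction.toPerm g⁻¹ : Equiv.Perm E)) e
    rw [hconj, trace_pi_diagonal, trace_sumZeroPerm, trace_sumZeroPerm] at h
    exact h.symm
  obtain ⟨g, hg⟩ := exists_alternatingGroup_inv_ne n (by omega)
  have hfix := htrace g
  have hdim := htrace 1
  simp only [hg, Finset.filter_false, Finset.card_empty] at hfix
  simp only [inv_one, one_smul, OneMemClass.coe_one, Equiv.Perm.one_apply, Finset.filter_true,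
    Finset.card_univ, Fintype.card_fin] at hdim
  have hk : (Finset.univ.filter fun x : E => g⁻¹ • x = x).card + k = 1 := by
    have : ((Finset.univ.filter fun x : E => g⁻¹ • x = x).card : ℂ) + k = 1 := by
      push_cast at hfix
      linear_combination hfix
    exact_mod_cast this
  have hE : Fintype.card E = k * n + 1 := by
    have : (Fintype.card E : ℂ) = k * n + 1 := by
      push_cast at hdim
      linear_combination hdim
    exact_mod_cast this
  have hk' : k = 0 ∨ k = 1 := by omega
  rcases hk' with rfl | rfl <;> omega
end
end
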